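/- arXiv:math/0604198 — 3 statements merged into one kernel-verified Lean document; each statement's English description precedes it below -/
import Mathlib

section
/- Let H be a complex Hilbert space and let E and F be closed subspaces of H. If E is not essentially contained in F, then there exist ε > 0 and an orthonormal sequence (vₙ) of vectors in E such that dist(vₙ, F) ≥ ε for all n. -/
/-- `E` is *essentially contained* in `F` if for every `ε > 0` there is a closed
subspace `E₀ ⊆ E` of finite codimension in `E` such that every unit vector of
`E₀` is within distance `ε` of `F`. -/
def EssentiallyContained {H : Type*} [NormedAddCommGroup H] [InnerProductSpace ℂ H]
    (E F : Submodule ℂ H) : Prop :=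
  ∀ ε : ℝ, 0 < ε → ∃ E₀ : Submodule ℂ H, E₀ ≤ E ∧ IsClosed (E₀ : Set H) ∧
    FiniteDimensional ℂ (E ⧸ E₀.comap E.subtype) ∧
    ∀ v ∈ E₀, ‖v‖ = 1 → Metric.infDist v (F : Set H) ≤ ε

/-- The orthogonal complement of a finite-dimensional subspace has finite codimension in every
subspace. -/
theorem Submodule.finiteDimensional_quotient_comap_orthogonal {𝕜 H : Type*} [RCLike 𝕜]
    [NormedAddCommGroup H] [InnerProductSpace 𝕜 H] (E S : Submodule 𝕜 H)
    [FiniteDimensional 𝕜 S] :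
    FiniteDimensional 𝕜 (E ⧸ (E ⊓ Sᗮ).comap E.subtype) := by
  let f : E →ₗ[𝕜] S := S.orthogonalProjectionOnto.toLinearMap ∘ₗ E.subtype
  have hker : (E ⊓ Sᗮ).comap E.subtype = LinearMap.ker f := by
    ext x
    simp [f]
  rw [hker]
  exact f.quotKerEquivRange.symm.finiteDimensional

/-- If `E` is not essentially contained in `F`, then there are `ε > 0` and an
orthonormal sequence `(vₙ)` in `E` with `dist(vₙ, F) ≥ ε` for all `n`. -/
theorem exists_orthonormal_seq_of_not_essentiallyContained {H : Type*}
    [NormedAddCommGroup H] [InnerProductSpace ℂ H] [CompleteSpace H]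
    (E F : Submodule ℂ H) (hE : IsClosed (E : Set H)) (hF : IsClosed (F : Set H))
    (h : ¬ EssentiallyContained E F) :
    ∃ ε : ℝ, 0 < ε ∧ ∃ v : ℕ → H, Orthonormal ℂ v ∧ (∀ n, v n ∈ E) ∧
      ∀ n, ε ≤ Metric.infDist (v n) (F : Set H) := by
  unfold EssentiallyContained at h
  push Not at h
  obtain ⟨ε, hε, h⟩ := h
  obtain ⟨v, hv, hvorth⟩ := exists_seq_of_forall_finset_exists
    (fun x : H => x ∈ E ∧ ‖x‖ = 1 ∧ ε ≤ Metric.infDist x (F : Set H))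
    (fun x y => inner ℂ x y = 0) (by
      intro s _
      let S : Submodule ℂ H := Submodule.span ℂ (s : Set H)
      obtain ⟨y, hy, hy1, hyF⟩ := h (E ⊓ Sᗮ) inf_le_left
        (hE.inter S.isClosed_orthogonal)
        (Submodule.finiteDimensional_quotient_comap_orthogonal E S)
      exact ⟨y, ⟨hy.1, hy1, hyF.le⟩, fun x hx =>
        (Submodule.mem_orthogonal S y).1 hy.2 x (Submodule.subset_span hx)⟩)
  refine ⟨ε, hε, v, ⟨fun n => (hv n).2.1, fun m n hmn => ?_⟩, fun n => (hv n).1,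
    fun n => (hv n).2.2⟩
  rcases hmn.lt_or_gt with hlt | hgt
  · exact hvorth m n hlt
  · exact inner_eq_zero_symm.1 (hvorth n m hgt)
end

section
/- In ℓ²(ℕ, ℂ) with standard orthonormal basis (eₙ), let E be the closed subspace generated by the vectors e_{2n} for n ≥ 1, and let F be the closed subspace generated by the vectors e_{2n} + (1/n) e_{2n+1} for n ≥ 1. Then E is essentially contained in F and F is essentially contained in E. -/
/-- The standard orthonormal basis vector `eₙ` of `ℓ²(ℕ, ℂ)`. -/
noncomputable def stdBasis (n : ℕ) : lp (fun _ : ℕ => ℂ) 2 := lp.single 2 n (1 : ℂ)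

open Filter Topology in
/-- A sequence of orthogonal vectors of norm at least one spans a closed subspace that is
essentially contained in the one spanned by a perturbation by orthogonal vectors tending to zero. -/
theorem EssentiallyContained.of_orthogonal_perturbation {H : Type*} [NormedAddCommGroup H]
    [InnerProductSpace ℂ H] {u w : ℕ → H}
    (hu : Pairwise fun i j => inner ℂ (u i) (u j) = 0) (hu_norm : ∀ n, 1 ≤ ‖u n‖)
    (hd : Pairwise fun i j => inner ℂ (u i - w i) (u j - w j) = 0)
    (hd_lim : Tendsto (fun n => ‖u n - w n‖) atTop (𝓝 0)) :
    EssentiallyContained (Submodule.span ℂ (Set.range u)).topologicalClosure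
      (Submodule.span ℂ (Set.range w)).topologicalClosure := by
  intro ε hε
  obtain ⟨N, hN⟩ := eventually_atTop.1 (hd_lim.eventually_le_const hε)
  set E₀ := (Submodule.span ℂ (Set.image u (Set.Ici N))).topologicalClosure
  have hE : E₀ ≤ (Submodule.span ℂ (Set.range u)).topologicalClosure :=
    Submodule.topologicalClosure_mono (Submodule.span_mono (Set.image_subset_range _ _))
  refine ⟨E₀, hE, Submodule.isClosed_topologicalClosure _, ?_, ?_⟩
  · set G := Submodule.span ℂ (Set.image u (Set.Iio N))
    have : FiniteDimensional ℂ G :=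
      FiniteDimensional.span_of_finite ℂ ((Set.finite_Iio N).image u)
    have hGE : G ≤ (Submodule.span ℂ (Set.range u)).topologicalClosure :=
      (Submodule.span_mono (Set.image_subset_range _ _)).trans
        (Submodule.le_topologicalClosure _)
    have hsup : (Submodule.span ℂ (Set.range u)).topologicalClosure ≤ E₀ ⊔ G := by
      refine Submodule.topologicalClosure_minimal _ ?_
        (Submodule.isClosed_sup_finiteDimensional _ _
          (Submodule.isClosed_topologicalClosure _))
      rw [Submodule.span_le]
      rintro _ ⟨n, rfl⟩
      rcases lt_or_ge n N with h | h
      · exact Submodule.mem_sup_right (Submodule.subset_span ⟨n, h, rfl⟩)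
      · exact Submodule.mem_sup_left
          (Submodule.le_topologicalClosure _ (Submodule.subset_span ⟨n, h, rfl⟩))
    refine Module.Finite.of_surjective ((Submodule.mkQ _).comp (Submodule.inclusion hGE)) ?_
    intro q
    obtain ⟨⟨x, hx⟩, rfl⟩ := Submodule.mkQ_surjective _ q
    obtain ⟨y, hy, z, hz, rfl⟩ := Submodule.mem_sup.1 (hsup hx)
    refine ⟨⟨z, hz⟩, ?_⟩
    simp only [LinearMap.comp_apply, Submodule.mkQ_apply]
    rw [eq_comm, Submodule.Quotient.eq]
    simpa using hy
  · have key : ∀ v ∈ E₀, Metric.infDist v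
        ((Submodule.span ℂ (Set.range w)).topologicalClosure : Set H) ≤ ε * ‖v‖ := by
      intro v hv
      have hclosed : IsClosed {v : H | Metric.infDist v
          ((Submodule.span ℂ (Set.range w)).topologicalClosure : Set H) ≤ ε * ‖v‖} :=
        isClosed_le (Metric.continuous_infDist_pt _) (by fun_prop)
      refine closure_minimal ?_ hclosed hv
      intro v hv
      obtain ⟨c, hc, rfl⟩ := (Finsupp.mem_span_image_iff_linearCombination ℂ).1 hv
      have hcN : ∀ i ∈ c.support, N ≤ i := fun i hi => hc hi
      set y := Finsupp.linearCombination ℂ w c with hy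
      have hyF : y ∈ (Submodule.span ℂ (Set.range w)).topologicalClosure :=
        Submodule.le_topologicalClosure _
          (Finsupp.mem_span_range_iff_exists_finsupp.2 ⟨c, rfl⟩)
      refine (Metric.infDist_le_dist_of_mem hyF).trans ?_
      have hpyth : ∀ x : ℕ → H, (Pairwise fun i j => inner ℂ (x i) (x j) = 0) →
          ‖∑ i ∈ c.support, c i • x i‖ ^ 2 = ∑ i ∈ c.support, ‖c i‖ ^ 2 * ‖x i‖ ^ 2 := by
        intro x hx
        rw [← Complex.ofReal_inj, Complex.ofReal_pow]
        have h := inner_self_eq_norm_sq_to_K (𝕜 := ℂ) (∑ i ∈ c.support, c i • x i)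
        refine h.symm.trans ?_
        rw [sum_inner, Complex.ofReal_sum]
        refine Finset.sum_congr rfl fun i hi => ?_
        rw [inner_sum, Finset.sum_eq_single_of_mem i hi]
        · rw [inner_self_eq_norm_sq_to_K, norm_smul, ← mul_pow]
          simp
        · intro j _ hji
          rw [inner_smul_left, inner_smul_right, hx hji.symm]
          simp
      rw [dist_eq_norm]
      refine le_of_sq_le_sq ?_ (by positivity)
      have hsub : Finsupp.linearCombination ℂ u c - y =
          ∑ i ∈ c.support, c i • (u i - w i) := by
        simp [hy, Finsupp.linearCombination_apply, Finsupp.sum, smul_sub]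
      rw [hsub, hpyth _ hd, mul_pow, Finsupp.linearCombination_apply, Finsupp.sum, hpyth _ hu,
        Finset.mul_sum]
      refine Finset.sum_le_sum fun i hi => ?_
      have h1 : ‖u i - w i‖ ^ 2 ≤ ε ^ 2 := by gcongr; exact hN i (hcN i hi)
      have h2 : 1 ≤ ‖u i‖ ^ 2 := one_le_pow₀ (hu_norm i)
      calc ‖c i‖ ^ 2 * ‖u i - w i‖ ^ 2 ≤ ‖c i‖ ^ 2 * ε ^ 2 := by gcongr
        _ = ε ^ 2 * (‖c i‖ ^ 2 * 1) := by ring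
        _ ≤ ε ^ 2 * (‖c i‖ ^ 2 * ‖u i‖ ^ 2) := by gcongr
    intro v hv hv1
    simpa [hv1] using key v hv

theorem inner_stdBasis (m n : ℕ) :
    inner ℂ (stdBasis m) (stdBasis n) = if m = n then (1 : ℂ) else 0 := by
  rw [stdBasis, lp.inner_single_left]
  simp [stdBasis, Pi.single_apply]

theorem norm_stdBasis (n : ℕ) : ‖stdBasis n‖ = 1 := by
  simp [stdBasis, lp.norm_single]

/-- In `ℓ²(ℕ, ℂ)`, the closed subspace `E` spanned by the `e_{2n}` (`n ≥ 1`) and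
the closed subspace `F` spanned by the `e_{2n} + (1/n) e_{2n+1}` (`n ≥ 1`) are
essentially contained in each other. -/
theorem example_mutual_essential_containment :
    EssentiallyContained
      ((Submodule.span ℂ
        (Set.range fun n : ℕ => stdBasis (2 * (n + 1)))).topologicalClosure)
      ((Submodule.span ℂ
        (Set.range fun n : ℕ => stdBasis (2 * (n + 1)) +
          ((1 : ℂ) / (n + 1)) • stdBasis (2 * (n + 1) + 1))).topologicalClosure) ∧
    EssentiallyContained
      ((Submodule.span ℂ
        (Set.range fun n : ℕ => stdBasis (2 * (n + 1)) +
          ((1 : ℂ) / (n + 1)) • stdBasis (2 * (n + 1) + 1))).topologicalClosure)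
      ((Submodule.span ℂ
        (Set.range fun n : ℕ => stdBasis (2 * (n + 1)))).topologicalClosure) := by
  have ha : Pairwise fun i j : ℕ =>
      inner ℂ (stdBasis (2 * (i + 1))) (stdBasis (2 * (j + 1))) = 0 := by
    intro i j hij
    rw [inner_stdBasis, if_neg (by omega)]
  have hb : Pairwise fun i j : ℕ =>
      inner ℂ (stdBasis (2 * (i + 1)) + ((1 : ℂ) / (i + 1)) • stdBasis (2 * (i + 1) + 1))
        (stdBasis (2 * (j + 1)) + ((1 : ℂ) / (j + 1)) • stdBasis (2 * (j + 1) + 1)) = 0 := by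
    intro i j hij
    simp only [inner_add_left, inner_add_right, inner_smul_left, inner_smul_right,
      inner_stdBasis]
    rw [if_neg (by omega), if_neg (by omega), if_neg (by omega), if_neg (by omega)]
    simp
  have hd : Pairwise fun i j : ℕ =>
      inner ℂ (((1 : ℂ) / (i + 1)) • stdBasis (2 * (i + 1) + 1))
        (((1 : ℂ) / (j + 1)) • stdBasis (2 * (j + 1) + 1)) = 0 := by
    intro i j hij
    rw [inner_smul_left, inner_smul_right, inner_stdBasis, if_neg (by omega)]
    simp
  have hlim : Filter.Tendsto
      (fun n : ℕ => ‖((1 : ℂ) / (n + 1)) • stdBasis (2 * (n + 1) + 1)‖)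
      Filter.atTop (nhds 0) := by
    refine tendsto_one_div_add_atTop_nhds_zero_nat.congr fun n => ?_
    rw [norm_smul, norm_stdBasis, mul_one, norm_div, norm_one, ← Nat.cast_succ, ← Nat.cast_succ,
      Complex.norm_natCast]
  have hb_norm (n : ℕ) :
      1 ≤ ‖stdBasis (2 * (n + 1)) + ((1 : ℂ) / (n + 1)) • stdBasis (2 * (n + 1) + 1)‖ := by
    have h := norm_add_sq_eq_norm_sq_add_norm_sq_of_inner_eq_zero (𝕜 := ℂ) (stdBasis (2 * (n + 1)))
      (((1 : ℂ) / (n + 1)) • stdBasis (2 * (n + 1) + 1))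
      (by rw [inner_smul_right, inner_stdBasis, if_neg (by omega), mul_zero])
    rw [norm_stdBasis] at h
    nlinarith [norm_nonneg (stdBasis (2 * (n + 1)) +
      ((1 : ℂ) / (n + 1)) • stdBasis (2 * (n + 1) + 1)),
      mul_self_nonneg ‖((1 : ℂ) / (n + 1)) • stdBasis (2 * (n + 1) + 1)‖]
  constructor
  · refine .of_orthogonal_perturbation ha (fun n => (norm_stdBasis _).ge) ?_ ?_
    · simpa only [sub_add_cancel_left, inner_neg_neg] using hd
    · simpa only [sub_add_cancel_left, norm_neg] using hlim
  · refine .of_orthogonal_perturbation hb hb_norm ?_ ?_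
    · simpa only [add_sub_cancel_left] using hd
    · simpa only [add_sub_cancel_left] using hlim
end

section
/- In ℓ²(ℕ, ℂ) with standard orthonormal basis (eₙ), let E be the closed subspace generated by the vectors e_{2n} for n ≥ 1, and let F be the closed subspace generated by the vectors e_{2n} + (1/n) e_{2n+1} for n ≥ 1. Then for every finite-dimensional subspace M of ℓ²(ℕ, ℂ), E is not contained in F + M and F is not contained in E + M; that is, neither of E, F is contained in a finite-dimensional extension of the other. -/
open Submodule in
/-- A continuous linear map which kills `b` and sends `a` to an infinite linearly independent family
shows that the closed span of `a` lies in no finite-dimensional extension of that of `b`. -/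
theorem not_topologicalClosure_span_le_sup {𝕜 H V ι κ : Type*} [NormedField 𝕜]
    [NormedAddCommGroup H] [NormedSpace 𝕜 H] [AddCommGroup V] [Module 𝕜 V] [TopologicalSpace V]
    [T1Space V] [Infinite ι] {a : ι → H} {b : κ → H} (L : H →L[𝕜] V)
    (ha : LinearIndependent 𝕜 fun i => L (a i)) (hb : ∀ k, L (b k) = 0)
    (M : Submodule 𝕜 H) [FiniteDimensional 𝕜 M] :
    ¬ (span 𝕜 (Set.range a)).topologicalClosure ≤
      (span 𝕜 (Set.range b)).topologicalClosure ⊔ M := by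
  intro h
  have hker : (span 𝕜 (Set.range b)).topologicalClosure ≤ L.toLinearMap.ker :=
    topologicalClosure_minimal _ (span_le.2 (by rintro _ ⟨k, rfl⟩; exact hb k)) L.isClosed_ker
  have hmem (i : ι) : L (a i) ∈ M.map L.toLinearMap := by
    obtain ⟨y, hy, m, hm, hym⟩ := mem_sup.1
      (h (le_topologicalClosure _ (subset_span (Set.mem_range_self i))))
    have hy0 : L y = 0 := hker hy
    exact ⟨m, hm, by simp [← hym, hy0]⟩
  have hfin : LinearIndependent 𝕜 fun i => (⟨L (a i), hmem i⟩ : M.map L.toLinearMap) :=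
    LinearIndependent.of_comp (M.map L.toLinearMap).subtype ha
  exact not_finite_iff_infinite.2 ‹Infinite ι› hfin.finite

theorem evalCLM_stdBasis (n m : ℕ) :
    lp.evalCLM ℂ (fun _ : ℕ => ℂ) 2 n (stdBasis m) = if n = m then 1 else 0 := by
  simp [stdBasis, lp.evalCLM, lp.single_apply, Pi.single_apply]

/-- In `ℓ²(ℕ, ℂ)`, let `E` be the closed subspace spanned by the `e_{2n}`
(`n ≥ 1`) and `F` the closed subspace spanned by the `e_{2n} + (1/n) e_{2n+1}`
(`n ≥ 1`). Then neither of `E`, `F` is contained in a finite-dimensional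
extension of the other. -/
theorem example_not_finite_dimensional_extension :
    ∀ M : Submodule ℂ (lp (fun _ : ℕ => ℂ) 2), FiniteDimensional ℂ M →
      ¬ ((Submodule.span ℂ
            (Set.range fun n : ℕ => stdBasis (2 * (n + 1)))).topologicalClosure ≤
          (Submodule.span ℂ
            (Set.range fun n : ℕ => stdBasis (2 * (n + 1)) +
              ((1 : ℂ) / (n + 1)) • stdBasis (2 * (n + 1) + 1))).topologicalClosure ⊔ M) ∧
      ¬ ((Submodule.span ℂ
            (Set.range fun n : ℕ => stdBasis (2 * (n + 1)) +
              ((1 : ℂ) / (n + 1)) • stdBasis (2 * (n + 1) + 1))).topologicalClosure ≤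
          (Submodule.span ℂ
            (Set.range fun n : ℕ => stdBasis (2 * (n + 1)))).topologicalClosure ⊔ M) := by
  intro M hM
  have hne (n : ℕ) : (1 : ℂ) / (n + 1) ≠ 0 := one_div_ne_zero n.cast_add_one_ne_zero
  have hodd (n m : ℕ) : 2 * (n + 1) + 1 ≠ 2 * (m + 1) := by omega
  have heven (n m : ℕ) : 2 * (n + 1) ≠ 2 * (m + 1) + 1 := by omega
  constructor
  · refine not_topologicalClosure_span_le_sup (ContinuousLinearMap.pi fun n : ℕ =>
      lp.evalCLM ℂ (fun _ : ℕ => ℂ) 2 (2 * (n + 1) + 1) -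
        ((1 : ℂ) / (n + 1)) • lp.evalCLM ℂ (fun _ : ℕ => ℂ) 2 (2 * (n + 1))) ?_ ?_ M
    · convert! Pi.linearIndependent_single_of_ne_zero (R := ℂ)
        (v := fun n : ℕ => -((1 : ℂ) / (n + 1))) (fun n => neg_ne_zero.2 (hne n)) using 1
      ext m n
      obtain rfl | h := eq_or_ne n m <;> simp [evalCLM_stdBasis, *]
    · intro m
      ext n
      obtain rfl | h := eq_or_ne n m <;> simp [evalCLM_stdBasis, *]
  · refine not_topologicalClosure_span_le_sup (ContinuousLinearMap.pi fun n : ℕ =>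
      lp.evalCLM ℂ (fun _ : ℕ => ℂ) 2 (2 * (n + 1) + 1)) ?_ ?_ M
    · convert! Pi.linearIndependent_single_of_ne_zero (R := ℂ)
        (v := fun n : ℕ => (1 : ℂ) / (n + 1)) hne using 1
      ext m n
      obtain rfl | h := eq_or_ne n m <;> simp [evalCLM_stdBasis, *]
    · intro m
      ext n
      simp [evalCLM_stdBasis, hodd]
end
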